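/- (Configuration H(8,137)) Let Z be a set of 8 points in the complex projective plane ℙ² forming the following configuration: a line ℓ containing exactly five of the points, among them three points Q₁, Q₂, C; a point P not on ℓ; a point A on the line PQ₁ with A ∉ {P, Q₁} and A ∉ ℓ; a point B on the line PQ₂ with B ∉ {P, Q₂} and B ∉ ℓ; the points A, B, C are collinear; and the only triples of collinear points among the eight are those contained in ℓ, in the line through P, Q₁, A, in the line through P, Q₂, B, and in the line through A, B, C. Let I be the radical homogeneous ideal of Z. Then α̂(I) = 7/3; moreover, the first differences of the initial sequence of I are periodic with period (3,2,2): for every k ≥ 0 one has α(I^(3k+1)) = 7k + 3, α(I^(3k+2)) = 7k + 5, and α(I^(3k+3)) = 7k + 7. -/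

import Mathlib

open scoped LinearAlgebra.Projectivization

/-- A polynomial `F` vanishes to order at least `m` at the (affine representative) point
`v`: all iterated partial derivatives of order `≤ m - 1` (i.e. of order `< m`) vanish at `v`. -/
def VanishesToOrder (m : ℕ) (F : MvPolynomial (Fin 3) ℂ) (v : Fin 3 → ℂ) : Prop :=
  ∀ k : ℕ, k < m → ∀ d : Fin k → Fin 3,
    MvPolynomial.eval v ((List.ofFn d).foldl (fun p i => MvPolynomial.pderiv i p) F) = 0

/-- The `m`-th symbolic power of the (radical) ideal of a set `Z` of points of `ℙ²`:
all polynomials vanishing to order at least `m` at every point of `Z`. -/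
def symbolicPower (Z : Set (ℙ ℂ (Fin 3 → ℂ))) (m : ℕ) : Set (MvPolynomial (Fin 3) ℂ) :=
  {F | ∀ P ∈ Z, ∀ (v : Fin 3 → ℂ) (hv : v ≠ 0),
    Projectivization.mk ℂ v hv = P → VanishesToOrder m F v}

/-- The initial degree `α` of a set of polynomials: the least `t` such that the set contains
a nonzero homogeneous polynomial of degree `t`. -/
noncomputable def initialDegree (S : Set (MvPolynomial (Fin 3) ℂ)) : ℕ :=
  sInf {t | ∃ F ∈ S, F ≠ 0 ∧ F.IsHomogeneous t}

/-- The Waldschmidt constant `α̂(I) = inf_{m ≥ 1} α(I^(m))/m` of the radical ideal of `Z`. -/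
noncomputable def waldschmidt (Z : Set (ℙ ℂ (Fin 3 → ℂ))) : ℝ :=
  ⨅ m : ℕ+, (initialDegree (symbolicPower Z (m : ℕ)) : ℝ) / ((m : ℕ) : ℝ)

/-- A (homogeneous equation of a) line in `ℙ²`: a nonzero homogeneous polynomial of degree 1. -/
def IsLine (L : MvPolynomial (Fin 3) ℂ) : Prop := L ≠ 0 ∧ L.IsHomogeneous 1

/-- The point `x ∈ ℙ²` lies on the line (or curve) with equation `L`. -/
def MemLine (L : MvPolynomial (Fin 3) ℂ) (x : ℙ ℂ (Fin 3 → ℂ)) : Prop :=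
  ∀ (v : Fin 3 → ℂ) (hv : v ≠ 0), Projectivization.mk ℂ v hv = x → MvPolynomial.eval v L = 0

/-- Three points of `ℙ²` are collinear if some line contains all of them. -/
def Collin (x y z : ℙ ℂ (Fin 3 → ℂ)) : Prop :=
  ∃ M, IsLine M ∧ MemLine M x ∧ MemLine M y ∧ MemLine M z

/-- `Z` is contained in a conic: the zero set of a nonzero homogeneous polynomial of degree 2
(possibly degenerate). -/
def ContainedInConic (Z : Set (ℙ ℂ (Fin 3 → ℂ))) : Prop :=
  ∃ F : MvPolynomial (Fin 3) ℂ, F ≠ 0 ∧ F.IsHomogeneous 2 ∧ ∀ x ∈ Z, MemLine F x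

/-- The configuration of points consisting of: a line `L` containing exactly `t` points of `Z`,
among them three points `Q₁, Q₂, C`; a point `P ∈ Z` not on `L`; a point `A ∈ Z` on the line
`L₁` through `P` and `Q₁`, with `A ∉ {P, Q₁}` and `A` off `L`; a point `B ∈ Z` on the line `L₂`
through `P` and `Q₂`, with `B ∉ {P, Q₂}` and `B` off `L`; the points `A, B, C` collinear (on a
line `L₃`); and the only triples of collinear points of `Z` are those contained in one of the
lines `L`, `L₁`, `L₂`, `L₃`. -/
def StandardConfig (t : ℕ) (Z : Set (ℙ ℂ (Fin 3 → ℂ))) : Prop :=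
  ∃ L L₁ L₂ L₃ : MvPolynomial (Fin 3) ℂ, ∃ Q₁ Q₂ C P A B : ℙ ℂ (Fin 3 → ℂ),
    IsLine L ∧ IsLine L₁ ∧ IsLine L₂ ∧ IsLine L₃ ∧
    Q₁ ∈ Z ∧ Q₂ ∈ Z ∧ C ∈ Z ∧ P ∈ Z ∧ A ∈ Z ∧ B ∈ Z ∧
    Q₁ ≠ Q₂ ∧ Q₁ ≠ C ∧ Q₂ ≠ C ∧
    MemLine L Q₁ ∧ MemLine L Q₂ ∧ MemLine L C ∧
    (Z ∩ {x | MemLine L x}).ncard = t ∧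
    ¬ MemLine L P ∧
    MemLine L₁ P ∧ MemLine L₁ Q₁ ∧ MemLine L₁ A ∧ A ≠ P ∧ A ≠ Q₁ ∧ ¬ MemLine L A ∧
    MemLine L₂ P ∧ MemLine L₂ Q₂ ∧ MemLine L₂ B ∧ B ≠ P ∧ B ≠ Q₂ ∧ ¬ MemLine L B ∧
    MemLine L₃ A ∧ MemLine L₃ B ∧ MemLine L₃ C ∧
    (∀ X Y W, X ∈ Z → Y ∈ Z → W ∈ Z → X ≠ Y → X ≠ W → Y ≠ W → Collin X Y W →
      ((MemLine L X ∧ MemLine L Y ∧ MemLine L W) ∨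
       (MemLine L₁ X ∧ MemLine L₁ Y ∧ MemLine L₁ W) ∨
       (MemLine L₂ X ∧ MemLine L₂ Y ∧ MemLine L₂ W) ∨
       (MemLine L₃ X ∧ MemLine L₃ Y ∧ MemLine L₃ W)))

open MvPolynomial

/-! ### Orders of vanishing -/

lemma vanishesToOrder_zero (F : MvPolynomial (Fin 3) ℂ) (v : Fin 3 → ℂ) :
    VanishesToOrder 0 F v := fun _ hk => absurd hk (Nat.not_lt_zero _)

lemma vanishesToOrder_succ_iff {m : ℕ} {F : MvPolynomial (Fin 3) ℂ} {v : Fin 3 → ℂ} :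
    VanishesToOrder (m + 1) F v ↔
      eval v F = 0 ∧ ∀ i, VanishesToOrder m (pderiv i F) v := by
  constructor
  · intro h
    refine ⟨by simpa using h 0 (Nat.succ_pos m) Fin.elim0, fun i k hk d => ?_⟩
    simpa [List.ofFn_succ] using h (k + 1) (by lia) (Fin.cons i d)
  · rintro ⟨h0, h1⟩ k hk d
    cases k with
    | zero => simpa using h0
    | succ k => simpa [List.ofFn_succ] using h1 (d 0) k (by lia) (fun j => d j.succ)

lemma VanishesToOrder.mono {m n : ℕ} {F : MvPolynomial (Fin 3) ℂ} {v : Fin 3 → ℂ}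
    (h : VanishesToOrder n F v) (hmn : m ≤ n) : VanishesToOrder m F v :=
  fun k hk d => h k (hk.trans_le hmn) d

lemma VanishesToOrder.add {m : ℕ} {F G : MvPolynomial (Fin 3) ℂ} {v : Fin 3 → ℂ}
    (hF : VanishesToOrder m F v) (hG : VanishesToOrder m G v) : VanishesToOrder m (F + G) v := by
  induction m generalizing F G with
  | zero => exact vanishesToOrder_zero _ _
  | succ m ih =>
    rw [vanishesToOrder_succ_iff] at hF hG ⊢
    refine ⟨by simp [hF.1, hG.1], fun i => ?_⟩
    rw [map_add]
    exact ih (hF.2 i) (hG.2 i)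

lemma VanishesToOrder.mul {m n : ℕ} {F G : MvPolynomial (Fin 3) ℂ} {v : Fin 3 → ℂ}
    (hF : VanishesToOrder m F v) (hG : VanishesToOrder n G v) :
    VanishesToOrder (m + n) (F * G) v := by
  induction hs : m + n generalizing m n F G with
  | zero => exact vanishesToOrder_zero _ _
  | succ s ih =>
    rw [vanishesToOrder_succ_iff]
    constructor
    · rcases m with _ | m
      · rcases n with _ | n
        · lia
        · simp [(vanishesToOrder_succ_iff.1 hG).1]
      · simp [(vanishesToOrder_succ_iff.1 hF).1]
    · intro i
      have hF' : VanishesToOrder (m - 1) (pderiv i F) v := by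
        rcases m with _ | m
        · exact vanishesToOrder_zero _ _
        · exact (vanishesToOrder_succ_iff.1 hF).2 i
      have hG' : VanishesToOrder (n - 1) (pderiv i G) v := by
        rcases n with _ | n
        · exact vanishesToOrder_zero _ _
        · exact (vanishesToOrder_succ_iff.1 hG).2 i
      rw [pderiv_mul]
      refine VanishesToOrder.add ?_ ?_
      · rcases m with _ | m
        · exact ih (m := 0) (n := s) (vanishesToOrder_zero _ _) (hG.mono (by lia)) (by lia)
        · exact ih hF' hG (by lia)
      · rcases n with _ | n
        · exact ih (m := s) (n := 0) (hF.mono (by lia)) (vanishesToOrder_zero _ _) (by lia)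
        · exact ih hF hG' (by lia)

lemma VanishesToOrder.pow {m : ℕ} {F : MvPolynomial (Fin 3) ℂ} {v : Fin 3 → ℂ}
    (hF : VanishesToOrder m F v) (k : ℕ) : VanishesToOrder (m * k) (F ^ k) v := by
  induction k with
  | zero => exact vanishesToOrder_zero _ _
  | succ k ih => rw [pow_succ, Nat.mul_succ]; exact ih.mul hF

lemma vanishesToOrder_one_of_eval_eq_zero {F : MvPolynomial (Fin 3) ℂ} {v : Fin 3 → ℂ}
    (h : eval v F = 0) : VanishesToOrder 1 F v :=
  vanishesToOrder_succ_iff.2 ⟨h, fun _ => vanishesToOrder_zero _ _⟩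

/-- The expansion `F(v + T x)` of `F` at `v`, as a polynomial in `T` whose coefficients are
polynomials in `x`. -/
noncomputable def taylorAt (v : Fin 3 → ℂ) :
    MvPolynomial (Fin 3) ℂ →ₐ[ℂ] Polynomial (MvPolynomial (Fin 3) ℂ) :=
  aeval fun i => Polynomial.C (C (v i)) + Polynomial.X * Polynomial.C (X i)

lemma coeff_zero_taylorAt (v : Fin 3 → ℂ) (F : MvPolynomial (Fin 3) ℂ) :
    (taylorAt v F).coeff 0 = C (eval v F) := by
  induction F using MvPolynomial.induction_on with
  | C a => simp [taylorAt, Polynomial.algebraMap_apply]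
  | add p q hp hq => simp [hp, hq]
  | mul_X p i hp => simp [Polynomial.mul_coeff_zero, hp]; simp [taylorAt]

lemma derivative_taylorAt (v : Fin 3 → ℂ) (F : MvPolynomial (Fin 3) ℂ) :
    Polynomial.derivative (taylorAt v F) =
      ∑ i, Polynomial.C (X i) * taylorAt v (pderiv i F) := by
  induction F using MvPolynomial.induction_on with
  | C a => simp [taylorAt, Polynomial.algebraMap_apply]
  | add p q hp hq => simp [hp, hq, mul_add, Finset.sum_add_distrib]
  | mul_X p j hp =>
    have hX : taylorAt v (X j) =
        Polynomial.C (C (v j)) + Polynomial.X * Polynomial.C (X j) := by simp [taylorAt]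
    have h1 : ∀ i, taylorAt v (pderiv i (X j : MvPolynomial (Fin 3) ℂ)) =
        if i = j then 1 else 0 := by
      intro i
      by_cases h : i = j
      · subst h; simp
      · simp [pderiv_X_of_ne (Ne.symm h), h]
    simp only [map_mul, Polynomial.derivative_mul, hp, pderiv_mul, map_add, h1, mul_add,
      Finset.sum_add_distrib, hX]
    simp [Finset.sum_mul, mul_assoc]
    ring

lemma VanishesToOrder.X_pow_dvd_taylorAt {m : ℕ} {F : MvPolynomial (Fin 3) ℂ} {v : Fin 3 → ℂ}
    (h : VanishesToOrder m F v) : Polynomial.X ^ m ∣ taylorAt v F := by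
  induction m generalizing F with
  | zero => simp
  | succ m ih =>
    rw [vanishesToOrder_succ_iff] at h
    have hd : Polynomial.X ^ m ∣ Polynomial.derivative (taylorAt v F) := by
      rw [derivative_taylorAt]
      exact Finset.dvd_sum fun i _ => (ih (h.2 i)).mul_left _
    rw [Polynomial.X_pow_dvd_iff] at hd ⊢
    intro d hdm
    cases d with
    | zero => rw [coeff_zero_taylorAt, h.1, map_zero]
    | succ d =>
      have h2 := hd d (by lia)
      rw [Polynomial.coeff_derivative] at h2
      exact (mul_eq_zero.1 h2).resolve_right (by exact_mod_cast Nat.succ_ne_zero d)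

/-! ### Linear forms and lines -/

lemma MvPolynomial.IsHomogeneous.exists_eq_sum_C_mul_X {M : MvPolynomial (Fin 3) ℂ}
    (hM : M.IsHomogeneous 1) : ∃ c : Fin 3 → ℂ, M = ∑ i, C (c i) * X i := by
  have h := (mem_homogeneousSubmodule 1 M).2 hM
  rw [homogeneousSubmodule_one_eq_span_X, Submodule.mem_span_range_iff_exists_fun] at h
  obtain ⟨c, rfl⟩ := h
  exact ⟨c, by simp [smul_eq_C_mul]⟩

lemma taylorAt_of_isHomogeneous_one {M : MvPolynomial (Fin 3) ℂ} (hM : M.IsHomogeneous 1)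
    (v : Fin 3 → ℂ) :
    taylorAt v M = Polynomial.C (C (eval v M)) + Polynomial.X * Polynomial.C M := by
  obtain ⟨c, rfl⟩ := hM.exists_eq_sum_C_mul_X
  simp only [map_sum, map_mul, Finset.mul_sum, ← Finset.sum_add_distrib]
  refine Finset.sum_congr rfl fun i _ => ?_
  simp [taylorAt, Polynomial.algebraMap_apply]
  ring

lemma MvPolynomial.IsHomogeneous.aeval_mul_left {t : ℕ} {F : MvPolynomial (Fin 3) ℂ}
    (hF : F.IsHomogeneous t) {R : Type*} [CommRing R] [Algebra ℂ R] (r : R) (f : Fin 3 → R) :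
    MvPolynomial.aeval (fun i => r * f i) F = r ^ t * MvPolynomial.aeval f F := by
  rw [aeval_def, aeval_def, eval₂_eq, eval₂_eq, Finset.mul_sum]
  refine Finset.sum_congr rfl fun d hd => ?_
  have : ∏ i ∈ d.support, r ^ d i = r ^ t := by
    rw [Finset.prod_pow_eq_pow_sum, ← hF.degree_eq_sum_deg_support hd]
  simp only [mul_pow, Finset.prod_mul_distrib, this]
  ring

lemma MvPolynomial.IsHomogeneous.eval_smul {t : ℕ} {F : MvPolynomial (Fin 3) ℂ}
    (hF : F.IsHomogeneous t) (r : ℂ) (v : Fin 3 → ℂ) : eval (r • v) F = r ^ t * eval v F := by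
  simpa [aeval_eq_eval, Pi.smul_def] using hF.aeval_mul_left r v

/-- A linear form contributes at most one to the order of vanishing at a point. -/
lemma X_pow_dvd_taylorAt_of_mul {m : ℕ} {M G : MvPolynomial (Fin 3) ℂ} {v : Fin 3 → ℂ}
    (hM : IsLine M) (hv : eval v M = 0) (h : Polynomial.X ^ m ∣ taylorAt v (M * G)) :
    Polynomial.X ^ (m - 1) ∣ taylorAt v G := by
  rcases m with _ | m
  · simp
  rw [map_mul, taylorAt_of_isHomogeneous_one hM.2, hv, map_zero, map_zero, zero_add, pow_succ',
    mul_assoc, mul_dvd_mul_iff_left Polynomial.X_ne_zero] at h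
  refine Polynomial.prime_X.pow_dvd_of_dvd_mul_left _ ?_ h
  simpa [Polynomial.X_dvd_iff] using hM.1

lemma X_pow_dvd_taylorAt_of_mul_of_ne {m : ℕ} {M G : MvPolynomial (Fin 3) ℂ} {v : Fin 3 → ℂ}
    (hv : eval v M ≠ 0) (h : Polynomial.X ^ m ∣ taylorAt v (M * G)) :
    Polynomial.X ^ m ∣ taylorAt v G := by
  rw [map_mul] at h
  refine Polynomial.prime_X.pow_dvd_of_dvd_mul_left _ ?_ h
  simpa [Polynomial.X_dvd_iff, coeff_zero_taylorAt] using hv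

lemma IsLine.exists_eval_eq_one {M : MvPolynomial (Fin 3) ℂ} (hM : IsLine M) :
    ∃ n, eval n M = 1 := by
  obtain ⟨n, hn⟩ : ∃ n, eval n M ≠ 0 := by
    by_contra! h
    exact hM.1 (MvPolynomial.funext fun x => by simpa using h x)
  refine ⟨(eval n M)⁻¹ • n, ?_⟩
  rw [hM.2.eval_smul, pow_one, inv_mul_cancel₀ hn]

lemma MvPolynomial.IsHomogeneous.eval_add {M : MvPolynomial (Fin 3) ℂ} (hM : M.IsHomogeneous 1)
    (u v : Fin 3 → ℂ) : eval (u + v) M = eval u M + eval v M := by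
  obtain ⟨c, rfl⟩ := hM.exists_eq_sum_C_mul_X
  simp [mul_add, Finset.sum_add_distrib]

/-- A polynomial vanishing on a plane through the origin is divisible by its equation. -/
lemma IsLine.dvd_of_forall_eval_eq_zero {M F : MvPolynomial (Fin 3) ℂ} (hM : IsLine M)
    (h : ∀ x, eval x M = 0 → eval x F = 0) : M ∣ F := by
  obtain ⟨n, hn⟩ := hM.exists_eval_eq_one
  let s : Fin 3 → MvPolynomial (Fin 3) ℂ := fun i => X i - C (n i) * M
  have hs : aeval s F = 0 := by
    refine MvPolynomial.funext fun x => ?_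
    have hx : eval x (aeval s F) = eval (x + (-eval x M) • n) F := by
      rw [← aeval_eq_eval, ← aeval_eq_eval]
      rw [← AlgHom.comp_apply, comp_aeval]
      congr 2
      ext i
      simp [s, aeval_eq_eval]
      ring
    rw [hx, map_zero]
    apply h
    rw [hM.2.eval_add, hM.2.eval_smul, hn]
    ring
  have hdvd : M ∣ F - aeval s F := by
    clear hs h
    induction F using MvPolynomial.induction_on with
    | C a => simp [algebraMap_eq]
    | add p q hp hq =>
      rw [map_add, add_sub_add_comm]
      exact dvd_add hp hq
    | mul_X p i hp =>
      have : p * X i - aeval s (p * X i) =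
          (p - aeval s p) * X i + aeval s p * C (n i) * M := by
        simp [s]; ring
      rw [this]
      exact dvd_add (hp.mul_right _) (dvd_mul_left _ _)
  rwa [hs, sub_zero] at hdvd

/-- The plane cut out by a linear form is spanned by two vectors. -/
lemma IsLine.exists_span {M : MvPolynomial (Fin 3) ℂ} (hM : IsLine M) :
    ∃ a b : Fin 3 → ℂ, ∀ x, eval x M = 0 → ∃ r s : ℂ, x = r • a + s • b := by
  let f : (Fin 3 → ℂ) →ₗ[ℂ] ℂ :=
    { toFun := fun x => eval x M
      map_add' := hM.2.eval_add
      map_smul' := fun r x => by simp [hM.2.eval_smul] }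
  obtain ⟨n, hn⟩ := hM.exists_eval_eq_one
  have hr : LinearMap.range f = ⊤ := by
    refine LinearMap.range_eq_top.2 fun y => ⟨y • n, ?_⟩
    change eval (y • n) M = y
    rw [hM.2.eval_smul, hn, pow_one, mul_one]
  have hk : Module.finrank ℂ (LinearMap.ker f) = 2 := by
    have := f.finrank_range_add_finrank_ker
    rw [hr] at this
    simp at this
    lia
  let B := Module.finBasisOfFinrankEq ℂ (LinearMap.ker f) hk
  refine ⟨B 0, B 1, fun x hx => ⟨B.repr ⟨x, hx⟩ 0, B.repr ⟨x, hx⟩ 1, ?_⟩⟩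
  have h := B.sum_repr ⟨x, hx⟩
  rw [Fin.sum_univ_two] at h
  exact (congrArg Subtype.val h).symm

/-- The plane cut out by a linear form has a parametrization `a + τ b` that reaches, up to
scaling, each member of a given finite family of nonzero vectors. -/
lemma IsLine.exists_parametrization {ι : Type*} {M : MvPolynomial (Fin 3) ℂ} (hM : IsLine M)
    (S : Finset ι) (v : ι → Fin 3 → ℂ) (hv : ∀ i ∈ S, eval (v i) M = 0)
    (h0 : ∀ i ∈ S, v i ≠ 0) :
    ∃ a b : Fin 3 → ℂ, (∀ x, eval x M = 0 → ∃ r s : ℂ, x = r • a + s • b) ∧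
      ∀ i ∈ S, ∃ r τ : ℂ, r ≠ 0 ∧ v i = r • (a + τ • b) := by
  classical
  obtain ⟨a, b, hab⟩ := hM.exists_span
  choose! r s hrs using hab
  obtain ⟨z, hz⟩ := Infinite.exists_notMem_finset (S.image fun i => r (v i) / s (v i))
  refine ⟨a, b + z • a, fun x hx => ⟨r x - z * s x, s x, ?_⟩, fun i hi => ?_⟩
  · conv_lhs => rw [hrs x hx]
    module
  · have hne : r (v i) - z * s (v i) ≠ 0 := by
      intro h
      by_cases hs : s (v i) = 0
      · apply h0 i hi
        rw [hrs _ (hv i hi), hs]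
        rw [hs, mul_zero, sub_zero] at h
        rw [h, zero_smul, zero_smul, add_zero]
      · refine hz (Finset.mem_image.2 ⟨i, hi, ?_⟩)
        field_simp
        linear_combination h
    refine ⟨_, s (v i) / (r (v i) - z * s (v i)), hne, ?_⟩
    conv_lhs => rw [hrs _ (hv i hi)]
    rw [smul_add, smul_smul, mul_div_cancel₀ _ hne]
    module

/-- The restriction of `F` to the parametrized line `a + T b`. -/
noncomputable def restrictLine (a b : Fin 3 → ℂ) : MvPolynomial (Fin 3) ℂ →ₐ[ℂ] Polynomial ℂ :=
  aeval fun i => Polynomial.C (a i) + Polynomial.X * Polynomial.C (b i)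

lemma eval_restrictLine (a b : Fin 3 → ℂ) (F : MvPolynomial (Fin 3) ℂ) (τ : ℂ) :
    (restrictLine a b F).eval τ = eval (a + τ • b) F := by
  rw [← Polynomial.coe_aeval_eq_eval, ← aeval_eq_eval]
  change Polynomial.aeval τ (aeval _ F) = aeval _ F
  rw [← AlgHom.comp_apply, comp_aeval]
  congr 2
  ext i
  simp
  exact mul_comm _ _

lemma natDegree_restrictLine_le {t : ℕ} {F : MvPolynomial (Fin 3) ℂ} (hF : F.IsHomogeneous t)
    (a b : Fin 3 → ℂ) : (restrictLine a b F).natDegree ≤ t := by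
  have := aeval_natDegree_le F hF.totalDegree_le
    (fun i => Polynomial.C (a i) + Polynomial.X * Polynomial.C (b i)) (n := 1)
    (fun i => by compute_degree)
  simpa [restrictLine] using this

lemma X_pow_dvd_restrictLine {m : ℕ} {F : MvPolynomial (Fin 3) ℂ} {v : Fin 3 → ℂ}
    (h : Polynomial.X ^ m ∣ taylorAt v F) (w : Fin 3 → ℂ) :
    Polynomial.X ^ m ∣ restrictLine v w F := by
  have h1 := map_dvd (Polynomial.mapAlgHom (aeval w : MvPolynomial (Fin 3) ℂ →ₐ[ℂ] ℂ)) h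
  have h2 : Polynomial.mapAlgHom (aeval w : MvPolynomial (Fin 3) ℂ →ₐ[ℂ] ℂ) (taylorAt v F) =
      restrictLine v w F := by
    rw [taylorAt, restrictLine, ← AlgHom.comp_apply, comp_aeval]
    congr 2
    ext1 i
    simp
  rwa [h2, map_pow, Polynomial.mapAlgHom, AlgHom.coe_mk, Polynomial.coe_mapRingHom,
    Polynomial.map_X] at h1

lemma X_sub_C_pow_dvd_restrictLine {m t : ℕ} {F : MvPolynomial (Fin 3) ℂ}
    (hF : F.IsHomogeneous t) {a b : Fin 3 → ℂ} {r τ : ℂ} (hr : r ≠ 0)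
    (h : Polynomial.X ^ m ∣ taylorAt (r • (a + τ • b)) F) :
    (Polynomial.X - Polynomial.C τ) ^ m ∣ restrictLine a b F := by
  have h1 := map_dvd (Polynomial.compRingHom (Polynomial.X - Polynomial.C τ))
    (X_pow_dvd_restrictLine h (r • b))
  have h2 : Polynomial.compRingHom (Polynomial.X - Polynomial.C τ)
      (restrictLine (r • (a + τ • b)) (r • b) F) =
        Polynomial.C r ^ t * restrictLine a b F := by
    change (Polynomial.aeval (Polynomial.X - Polynomial.C τ)) (restrictLine _ _ F) = _
    rw [restrictLine, restrictLine, ← hF.aeval_mul_left, ← AlgHom.comp_apply, comp_aeval]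
    congr 2
    ext1 i
    simp
    ring
  rw [h2, map_pow] at h1
  have hu : IsUnit (Polynomial.C r ^ t) := (Polynomial.isUnit_C.2 hr.isUnit).pow t
  rw [hu.dvd_mul_left] at h1
  simpa using h1

/-- A line that is not a component of a plane curve meets it, counted with multiplicity, in at
most as many points as the degree of the curve. -/
lemma IsLine.sum_le_of_not_dvd {ι : Type*} {M F : MvPolynomial (Fin 3) ℂ} {t : ℕ}
    (hM : IsLine M) (hF : F.IsHomogeneous t) (hdvd : ¬ M ∣ F) (S : Finset ι)
    (v : ι → Fin 3 → ℂ) (hv : ∀ i ∈ S, eval (v i) M = 0) (h0 : ∀ i ∈ S, v i ≠ 0)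
    (hind : ∀ i ∈ S, ∀ j ∈ S, i ≠ j → ∀ r : ℂ, v i ≠ r • v j) (m : ι → ℕ)
    (hm : ∀ i ∈ S, Polynomial.X ^ m i ∣ taylorAt (v i) F) : ∑ i ∈ S, m i ≤ t := by
  obtain ⟨a, b, hab, hS⟩ := hM.exists_parametrization S v hv h0
  choose! r τ hr hvr using hS
  have hf : restrictLine a b F ≠ 0 := by
    intro hf
    have hzero : ∀ s, eval (a + s • b) F = 0 := fun s => by
      rw [← eval_restrictLine, hf, Polynomial.eval_zero]
    have hscale : ∀ x y : ℂ, x ≠ 0 → eval (x • a + y • b) F = 0 := fun x y hx => by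
      have : x • a + y • b = x • (a + (y / x) • b) := by
        rw [smul_add, smul_smul, mul_div_cancel₀ _ hx]
      rw [this, hF.eval_smul, hzero, mul_zero]
    refine hdvd (hM.dvd_of_forall_eval_eq_zero fun x hx => ?_)
    obtain ⟨p, q, rfl⟩ := hab x hx
    have hg : Polynomial.X * restrictLine (q • b) a F = 0 := by
      refine Polynomial.funext fun s => ?_
      by_cases hs : s = 0
      · simp [hs]
      · simp [eval_restrictLine, add_comm (q • b), hscale s q hs]
    have hg' := (mul_eq_zero.1 hg).resolve_left Polynomial.X_ne_zero
    rw [add_comm, ← eval_restrictLine, hg', Polynomial.eval_zero]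
  have hprod : ∏ i ∈ S, (Polynomial.X - Polynomial.C (τ i)) ^ m i ∣ restrictLine a b F := by
    refine Finset.prod_dvd_of_coprime (fun i hi j hj hij => ?_) fun i hi => ?_
    · refine (Polynomial.isCoprime_X_sub_C_of_isUnit_sub (Ne.isUnit ?_)).pow
      intro h
      refine hind i hi j hj hij (r i / r j) ?_
      conv_lhs => rw [hvr i hi]
      conv_rhs => rw [hvr j hj]
      rw [sub_eq_zero.1 h, smul_smul, div_mul_cancel₀ _ (hr j hj)]
    · have := hm i hi
      rw [hvr i hi] at this
      exact X_sub_C_pow_dvd_restrictLine hF (hr i hi) this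
  have hdeg := Polynomial.natDegree_le_of_dvd hprod hf
  rw [Polynomial.natDegree_prod_of_monic _ _ fun i _ => (Polynomial.monic_X_sub_C _).pow _] at hdeg
  simp only [Polynomial.natDegree_pow, Polynomial.natDegree_X_sub_C, mul_one] at hdeg
  exact hdeg.trans (natDegree_restrictLine_le hF a b)

lemma IsLine.exists_eq_mul_of_dvd {M F : MvPolynomial (Fin 3) ℂ} {t : ℕ} (hM : IsLine M)
    (hF : F.IsHomogeneous t) (hF0 : F ≠ 0) (hdvd : M ∣ F) :
    ∃ s G, t = s + 1 ∧ F = M * G ∧ G.IsHomogeneous s := by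
  obtain ⟨G, rfl⟩ := hdvd
  let := gradedAlgebra (σ := Fin 3) (R := ℂ)
  have hdec := DirectSum.decompose_of_mem_same (homogeneousSubmodule (Fin 3) ℂ)
    ((mem_homogeneousSubmodule t (M * G)).2 hF)
  have hM1 := (mem_homogeneousSubmodule 1 M).2 hM.2
  rcases t with _ | s
  · rw [DirectSum.coe_decompose_mul_of_left_mem_of_not_le _ hM1 (by simp)] at hdec
    exact absurd hdec.symm hF0
  · rw [DirectSum.coe_decompose_mul_of_left_mem_of_le _ hM1 (by simp)] at hdec
    exact ⟨s, _, rfl, hdec.symm, (mem_homogeneousSubmodule _ _).1 (SetLike.coe_mem _)⟩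

/-- If a configuration of lines has nonnegative intersection number with each of its members,
then its intersection number with every plane curve is nonnegative. -/
lemma sum_mul_card_le_of_lines {ι κ : Type*} [Fintype ι] [DecidableEq ι] [Fintype κ]
    (v : ι → Fin 3 → ℂ) (h0 : ∀ i, v i ≠ 0) (hind : ∀ i j, i ≠ j → ∀ r : ℂ, v i ≠ r • v j)
    (M : κ → MvPolynomial (Fin 3) ℂ) (hM : ∀ j, IsLine (M j)) (S : κ → Finset ι)
    (hS : ∀ j i, eval (v i) (M j) = 0 ↔ i ∈ S j)
    (hw : ∀ j, ∑ i ∈ S j, (Finset.univ.filter fun j' => i ∈ S j').card ≤ Fintype.card κ)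
    {t : ℕ} {F : MvPolynomial (Fin 3) ℂ} (hF0 : F ≠ 0) (hF : F.IsHomogeneous t) (m : ι → ℕ)
    (hm : ∀ i, Polynomial.X ^ m i ∣ taylorAt (v i) F) :
    ∑ i, m i * (Finset.univ.filter fun j => i ∈ S j).card ≤ Fintype.card κ * t := by
  induction t using Nat.strong_induction_on generalizing F m with
  | _ t ih =>
  by_cases hdvd : ∃ j, M j ∣ F
  · obtain ⟨j, hj⟩ := hdvd
    obtain ⟨s, G, rfl, rfl, hG⟩ := (hM j).exists_eq_mul_of_dvd hF hF0 hj
    have h1 := ih s s.lt_succ_self (right_ne_zero_of_mul hF0) hG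
      (fun i => if i ∈ S j then m i - 1 else m i) fun i => by
        split_ifs with hi
        · exact X_pow_dvd_taylorAt_of_mul (hM j) ((hS j i).2 hi) (hm i)
        · exact X_pow_dvd_taylorAt_of_mul_of_ne (fun h => hi ((hS j i).1 h)) (hm i)
    have h2 := hw j
    rw [← Finset.univ_inter (S j), ← Finset.sum_ite_mem] at h2
    rw [mul_add, mul_one]
    refine le_trans ?_ (add_le_add h1 h2)
    rw [← Finset.sum_add_distrib]
    refine Finset.sum_le_sum fun i _ => ?_
    split_ifs
    · rw [← Nat.succ_mul]
      exact Nat.mul_le_mul_right _ (by lia)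
    · exact Nat.le_add_right _ _
  · push Not at hdvd
    calc ∑ i, m i * (Finset.univ.filter fun j => i ∈ S j).card
        = ∑ j, ∑ i ∈ S j, m i := by
          simp only [Finset.card_filter, Finset.mul_sum, mul_ite, mul_one, mul_zero]
          rw [Finset.sum_comm]
          simp
      _ ≤ ∑ _j : κ, t := Finset.sum_le_sum fun j _ =>
          (hM j).sum_le_of_not_dvd hF (hdvd j) (S j) v (fun i hi => (hS j i).2 hi)
            (fun i _ => h0 i) (fun i _ k _ => hind i k) m fun i _ => hm i
      _ = Fintype.card κ * t := by simp

/-! ### Points and lines of the projective plane -/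

lemma memLine_iff_eval_rep {t : ℕ} {F : MvPolynomial (Fin 3) ℂ} (hF : F.IsHomogeneous t)
    (x : ℙ ℂ (Fin 3 → ℂ)) : MemLine F x ↔ eval x.rep F = 0 := by
  refine ⟨fun h => h _ x.rep_nonzero x.mk_rep, fun h v hv hx => ?_⟩
  rw [← x.mk_rep, Projectivization.mk_eq_mk_iff'] at hx
  obtain ⟨r, rfl⟩ := hx
  rw [hF.eval_smul, h, mul_zero]

lemma rep_ne_smul_rep {x y : ℙ ℂ (Fin 3 → ℂ)} (h : x ≠ y) (r : ℂ) : x.rep ≠ r • y.rep := by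
  intro hr
  apply h
  rw [← x.mk_rep, ← y.mk_rep, Projectivization.mk_eq_mk_iff']
  exact ⟨r, hr.symm⟩

/-- Two distinct points lie on at most one line. -/
lemma MemLine.of_two_points {M N : MvPolynomial (Fin 3) ℂ} (hM : IsLine M) (hN : IsLine N)
    {x y z : ℙ ℂ (Fin 3 → ℂ)} (hxy : x ≠ y) (hMx : MemLine M x) (hMy : MemLine M y)
    (hNx : MemLine N x) (hNy : MemLine N y) (hz : MemLine M z) : MemLine N z := by
  by_cases hdvd : M ∣ N
  · obtain ⟨G, rfl⟩ := hdvd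
    intro v hv hvz
    rw [map_mul, hz v hv hvz, zero_mul]
  · exfalso
    have hne : ∀ i j : Fin 2, i ≠ j → ![x, y] i ≠ ![x, y] j := by
      simp [Fin.forall_fin_two, hxy, hxy.symm]
    have hon : ∀ {F : MvPolynomial (Fin 3) ℂ}, MemLine F x → MemLine F y →
        ∀ i : Fin 2, eval (![x, y] i).rep F = 0 := by
      intro F hx hy
      simp [Fin.forall_fin_two, hx _ x.rep_nonzero x.mk_rep, hy _ y.rep_nonzero y.mk_rep]
    have := hM.sum_le_of_not_dvd hN.2 hdvd Finset.univ (fun i => (![x, y] i).rep)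
      (fun i _ => hon hMx hMy i) (fun i _ => Projectivization.rep_nonzero _)
      (fun i _ j _ hij => rep_ne_smul_rep (hne i j hij)) (fun _ => 1)
      (fun i _ => (vanishesToOrder_one_of_eval_eq_zero (hon hNx hNy i)).X_pow_dvd_taylorAt)
    simp at this

lemma exists_isLine_through (x y : ℙ ℂ (Fin 3 → ℂ)) :
    ∃ M, IsLine M ∧ MemLine M x ∧ MemLine M y := by
  obtain ⟨c, hc, hc0⟩ := Submodule.exists_mem_ne_zero_of_ne_bot
    (LinearMap.ker_ne_bot_of_finrank_lt (f := Matrix.toLin' (Matrix.of ![x.rep, y.rep]))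
      (by simp))
  have hM : (∑ i, C (c i) * X i : MvPolynomial (Fin 3) ℂ).IsHomogeneous 1 :=
    IsHomogeneous.sum _ _ _ fun i _ => isHomogeneous_C_mul_X _ _
  have hz := fun i => congrFun (LinearMap.mem_ker.1 hc) i
  refine ⟨_, ⟨fun h => hc0 ?_, hM⟩, (memLine_iff_eval_rep hM x).2 ?_,
    (memLine_iff_eval_rep hM y).2 ?_⟩
  · ext i
    simpa [Pi.single_apply] using congrArg (eval (Pi.single i 1)) h
  · simpa [Matrix.toLin'_apply, Matrix.mulVec, dotProduct, mul_comm] using hz 0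
  · simpa [Matrix.toLin'_apply, Matrix.mulVec, dotProduct, mul_comm] using hz 1

/-- There is a conic through any five points. -/
lemma exists_conic_through (x : Fin 5 → ℙ ℂ (Fin 3 → ℂ)) :
    ∃ K : MvPolynomial (Fin 3) ℂ, K ≠ 0 ∧ K.IsHomogeneous 2 ∧ ∀ i, MemLine K (x i) := by
  let A : Matrix (Fin 5) (Fin 3 ⊕ Fin 3) ℂ := Matrix.of fun i =>
    Sum.elim (fun j => (x i).rep j ^ 2) fun j => (x i).rep j * (x i).rep (j + 1)
  obtain ⟨c, hc, hc0⟩ := Submodule.exists_mem_ne_zero_of_ne_bot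
    (LinearMap.ker_ne_bot_of_finrank_lt (f := Matrix.toLin' A) (by simp))
  let K : MvPolynomial (Fin 3) ℂ :=
    ∑ j, (C (c (Sum.inl j)) * X j ^ 2 + C (c (Sum.inr j)) * (X j * X (j + 1)))
  have hK : K.IsHomogeneous 2 := IsHomogeneous.sum _ _ _ fun j _ =>
    ((isHomogeneous_X_pow j 2).C_mul _).add
      (((isHomogeneous_X ℂ j).mul (isHomogeneous_X ℂ _)).C_mul _)
  refine ⟨K, fun h => hc0 ?_, hK, fun i => (memLine_iff_eval_rep hK _).2 ?_⟩
  · have h1 : ∀ j, c (Sum.inl j) = 0 := by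
      intro j
      have := congrArg (eval (Pi.single j 1)) h
      fin_cases j <;> simpa [K, Fin.sum_univ_three] using this
    have h2 : ∀ j, c (Sum.inr j) = 0 := by
      intro j
      have := congrArg (eval (Pi.single j 1 + Pi.single (j + 1) 1)) h
      fin_cases j <;> simpa [K, Fin.sum_univ_three, h1] using this
    ext (j | j)
    · exact h1 j
    · exact h2 j
  · have := congrFun (LinearMap.mem_ker.1 hc) i
    simpa [A, K, Matrix.toLin'_apply, Matrix.mulVec, dotProduct, Finset.sum_add_distrib,
      mul_comm] using this

/-! ### The configuration -/

/-- The incidences of the configuration: the points `0, 1, 2` are `P, A, B`, the points `3, 4, 5`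
are `Q₁, Q₂, C`, and `6, 7` are the remaining points of the first line. -/
def incidence : Fin 4 → Finset (Fin 8) :=
  ![{3, 4, 5, 6, 7}, {0, 1, 3}, {0, 2, 4}, {1, 2, 5}]

/-- `x` and `N` label the points of `Z` and the lines of the configuration. -/
structure IsLabelling (Z : Set (ℙ ℂ (Fin 3 → ℂ))) (x : Fin 8 → ℙ ℂ (Fin 3 → ℂ))
    (N : Fin 4 → MvPolynomial (Fin 3) ℂ) : Prop where
  injective : Function.Injective x
  range_eq : Set.range x = Z
  isLine : ∀ k, IsLine (N k)
  memLine_iff : ∀ k i, MemLine (N k) (x i) ↔ i ∈ incidence k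

lemma StandardConfig.exists_isLabelling {Z : Set (ℙ ℂ (Fin 3 → ℂ))} (hfin : Z.Finite)
    (hcard : Z.ncard = 8) (h : StandardConfig 5 Z) : ∃ x N, IsLabelling Z x N := by
  obtain ⟨L, L₁, L₂, L₃, Q₁, Q₂, R, P, A, B, hL, hL₁, hL₂, hL₃, hQ₁Z, hQ₂Z, hRZ, hPZ, hAZ, hBZ,
    hQ₁Q₂, hQ₁R, hQ₂R, hLQ₁, hLQ₂, hLR, hcardL, hLP, h₁P, h₁Q₁, h₁A, hAP, -, hLA, h₂P, h₂Q₂,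
    h₂B, hBP, -, hLB, h₃A, h₃B, h₃R, -⟩ := h
  have off₁ : ∀ x, MemLine L x → x ≠ Q₁ → ¬ MemLine L₁ x := fun x hx hne h =>
    hLP (.of_two_points hL₁ hL hne h h₁Q₁ hx hLQ₁ h₁P)
  have off₂ : ∀ x, MemLine L x → x ≠ Q₂ → ¬ MemLine L₂ x := fun x hx hne h =>
    hLP (.of_two_points hL₂ hL hne h h₂Q₂ hx hLQ₂ h₂P)
  have off₃ : ∀ x, MemLine L x → x ≠ R → ¬ MemLine L₃ x := fun x hx hne h =>
    hLA (.of_two_points hL₃ hL hne h h₃R hx hLR h₃A)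
  have h₁B : ¬ MemLine L₁ B := fun h =>
    off₁ Q₂ hLQ₂ hQ₁Q₂.symm (.of_two_points hL₂ hL₁ hBP h₂B h₂P h h₁P h₂Q₂)
  have h₂A : ¬ MemLine L₂ A := fun h =>
    off₂ Q₁ hLQ₁ hQ₁Q₂ (.of_two_points hL₁ hL₂ hAP h₁A h₁P h h₂P h₁Q₁)
  have h₃P : ¬ MemLine L₃ P := fun h =>
    off₃ Q₁ hLQ₁ hQ₁R (.of_two_points hL₁ hL₃ hAP h₁A h₁P h₃A h h₁Q₁)
  have hAB : A ≠ B := fun h => h₁B (h ▸ h₁A)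
  have hQR : ({Q₁, Q₂, R} : Set (ℙ ℂ (Fin 3 → ℂ))) ⊆ Z ∩ {x | MemLine L x} := by
    rintro y (rfl | rfl | rfl)
    exacts [⟨hQ₁Z, hLQ₁⟩, ⟨hQ₂Z, hLQ₂⟩, ⟨hRZ, hLR⟩]
  obtain ⟨D, E, -, hrest⟩ : ∃ D E, D ≠ E ∧ (Z ∩ {x | MemLine L x}) \ {Q₁, Q₂, R} = {D, E} := by
    rw [← Set.ncard_eq_two, Set.ncard_sdiff hQR (Set.toFinite _), hcardL,
      Set.ncard_eq_three.2 ⟨Q₁, Q₂, R, hQ₁Q₂, hQ₁R, hQ₂R, rfl⟩]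
  have hD : D ∈ (Z ∩ {x | MemLine L x}) \ {Q₁, Q₂, R} := by simp [hrest]
  have hE : E ∈ (Z ∩ {x | MemLine L x}) \ {Q₁, Q₂, R} := by simp [hrest]
  simp only [Set.mem_sdiff, Set.mem_inter_iff, Set.mem_ofPred_eq, Set.mem_insert_iff,
    Set.mem_singleton_iff, not_or] at hD hE
  obtain ⟨⟨hDZ, hLD⟩, hDQ₁, hDQ₂, hDR⟩ := hD
  obtain ⟨⟨hEZ, hLE⟩, hEQ₁, hEQ₂, hER⟩ := hE
  have hoff : {P, A, B} = Z \ {x | MemLine L x} := by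
    refine Set.eq_of_subset_of_ncard_le ?_ ?_ (hfin.subset Set.sdiff_subset)
    · rintro y (rfl | rfl | rfl)
      exacts [⟨hPZ, hLP⟩, ⟨hAZ, hLA⟩, ⟨hBZ, hLB⟩]
    · have := Set.ncard_inter_add_ncard_sdiff_eq_ncard Z {x | MemLine L x} hfin
      rw [Set.ncard_eq_three.2 ⟨P, A, B, hAP.symm, hBP.symm, hAB, rfl⟩]
      lia
  have hrange : Set.range ![P, A, B, Q₁, Q₂, R, D, E] = Z := by
    refine Set.Subset.antisymm ?_ fun y hy => ?_
    · rintro _ ⟨i, rfl⟩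
      fin_cases i <;> assumption
    · by_cases hyL : MemLine L y
      · by_cases hyQ : y ∈ ({Q₁, Q₂, R} : Set (ℙ ℂ (Fin 3 → ℂ)))
        · rcases hyQ with rfl | rfl | rfl
          exacts [⟨3, rfl⟩, ⟨4, rfl⟩, ⟨5, rfl⟩]
        · have : y ∈ ({D, E} : Set (ℙ ℂ (Fin 3 → ℂ))) := hrest ▸ ⟨⟨hy, hyL⟩, hyQ⟩
          rcases this with rfl | rfl
          exacts [⟨6, rfl⟩, ⟨7, rfl⟩]
      · have : y ∈ ({P, A, B} : Set (ℙ ℂ (Fin 3 → ℂ))) := hoff ▸ ⟨hy, hyL⟩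
        rcases this with rfl | rfl | rfl
        exacts [⟨0, rfl⟩, ⟨1, rfl⟩, ⟨2, rfl⟩]
  refine ⟨![P, A, B, Q₁, Q₂, R, D, E], ![L, L₁, L₂, L₃], ?_, hrange, ?_, ?_⟩
  · rw [← Set.injOn_univ]
    refine Set.injOn_of_ncard_image_eq ?_ Set.finite_univ
    rw [Set.image_univ, hrange, hcard]
    simp
  · simp [Fin.forall_fin_succ, hL, hL₁, hL₂, hL₃]
  · have := off₁ Q₂ hLQ₂ hQ₁Q₂.symm
    have := off₁ R hLR hQ₁R.symm
    have := off₁ D hLD hDQ₁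
    have := off₁ E hLE hEQ₁
    have := off₂ Q₁ hLQ₁ hQ₁Q₂
    have := off₂ R hLR hQ₂R.symm
    have := off₂ D hLD hDQ₂
    have := off₂ E hLE hEQ₂
    have := off₃ Q₁ hLQ₁ hQ₁R
    have := off₃ Q₂ hLQ₂ hQ₂R
    have := off₃ D hLD hDR
    have := off₃ E hLE hER
    intro k i
    fin_cases k <;> fin_cases i <;> simpa [incidence]

section Labelling

variable {Z : Set (ℙ ℂ (Fin 3 → ℂ))} {x : Fin 8 → ℙ ℂ (Fin 3 → ℂ)}
  {N : Fin 4 → MvPolynomial (Fin 3) ℂ}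

/-- The nine lines bounding the initial degree from below: the three lines of the configuration
with three points, and the six lines joining `P, A, B` to the two points lying on only one line
of the configuration. -/
def boundingIncidence : Fin 3 ⊕ Fin 3 × Fin 2 → Finset (Fin 8) :=
  Sum.elim (fun k => incidence k.succ) fun u => {Fin.castLE (by simp) u.1, Fin.natAdd 6 u.2}

lemma IsLabelling.exists_boundingLines (h : IsLabelling Z x N) :
    ∃ M : Fin 3 ⊕ Fin 3 × Fin 2 → MvPolynomial (Fin 3) ℂ, (∀ j, IsLine (M j)) ∧
      ∀ j i, MemLine (M j) (x i) ↔ i ∈ boundingIncidence j := by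
  choose J hJ hJl hJr using fun u : Fin 3 × Fin 2 =>
    exists_isLine_through (x (Fin.castLE (by simp) u.1)) (x (Fin.natAdd 6 u.2))
  refine ⟨Sum.elim (fun k => N k.succ) J, ?_, ?_⟩
  · rintro (k | u)
    exacts [h.isLine _, hJ u]
  · rintro (k | u) i
    · exact h.memLine_iff _ _
    · simp only [boundingIncidence, Sum.elim_inr, Finset.mem_insert, Finset.mem_singleton]
      constructor
      · intro hi
        by_contra hne
        rw [not_or] at hne
        have hcomb : ∀ u : Fin 3 × Fin 2, ∀ i : Fin 8, i ≠ Fin.castLE (by simp) u.1 →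
            i ≠ Fin.natAdd 6 u.2 → ∃ k, i ∈ incidence k ∧
              (Fin.castLE (by simp) u.1 ∈ incidence k ∧ Fin.natAdd 6 u.2 ∉ incidence k ∨
                Fin.natAdd 6 u.2 ∈ incidence k ∧ Fin.castLE (by simp) u.1 ∉ incidence k) := by
          decide
        obtain ⟨k, hik, ⟨hl, hr⟩ | ⟨hr, hl⟩⟩ := hcomb u i hne.1 hne.2
        all_goals rw [← h.memLine_iff] at hik hl hr
        · exact hr (.of_two_points (hJ u) (h.isLine k) (h.injective.ne hne.1) hi (hJl u) hik hl
            (hJr u))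
        · exact hl (.of_two_points (hJ u) (h.isLine k) (h.injective.ne hne.2) hi (hJr u) hik hr
            (hJl u))
      · rintro (rfl | rfl)
        exacts [hJl u, hJr u]

lemma IsLabelling.seven_mul_le (h : IsLabelling Z x N) {m t : ℕ} {F : MvPolynomial (Fin 3) ℂ}
    (hFZ : F ∈ symbolicPower Z m) (hF0 : F ≠ 0) (hF : F.IsHomogeneous t) : 7 * m ≤ 3 * t := by
  obtain ⟨M, hM, hinc⟩ := h.exists_boundingLines
  have := sum_mul_card_le_of_lines (fun i => (x i).rep) (fun i => (x i).rep_nonzero)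
    (fun i j hij => rep_ne_smul_rep (h.injective.ne hij)) M hM boundingIncidence
    (fun j i => by rw [← hinc, memLine_iff_eval_rep (hM j).2]) (by decide) hF0 hF (fun _ => m)
    (fun i => (hFZ (x i) (h.range_eq ▸ Set.mem_range_self i) _ (x i).rep_nonzero
      (x i).mk_rep).X_pow_dvd_taylorAt)
  have hsum : ∑ i, (Finset.univ.filter fun j => i ∈ boundingIncidence j).card = 21 := by decide
  rw [← Finset.mul_sum, hsum] at this
  simp at this
  lia

lemma IsLabelling.exists_mem_symbolicPower (h : IsLabelling Z x N) (e : Fin 4 → ℕ) (f m : ℕ)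
    (hm : ∀ i, m ≤ (∑ k, if i ∈ incidence k then e k else 0) +
      if i ∈ ({0, 1, 2, 6, 7} : Finset (Fin 8)) then f else 0) :
    ∃ F ∈ symbolicPower Z m, F ≠ 0 ∧ F.IsHomogeneous (∑ k, e k + 2 * f) := by
  obtain ⟨K, hK0, hK, hKx⟩ := exists_conic_through ![x 0, x 1, x 2, x 6, x 7]
  refine ⟨(∏ k, N k ^ e k) * K ^ f, ?_, ?_, ?_⟩
  · rw [← h.range_eq]
    rintro _ ⟨i, rfl⟩ v hv hvx
    refine VanishesToOrder.mono (VanishesToOrder.mul ?_ ?_) (hm i)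
    · have hk : ∀ k, VanishesToOrder (if i ∈ incidence k then e k else 0) (N k ^ e k) v := by
        intro k
        split_ifs with hi
        · simpa using (vanishesToOrder_one_of_eval_eq_zero
            ((h.memLine_iff k i).2 hi v hv hvx)).pow (e k)
        · exact vanishesToOrder_zero _ _
      rw [Fin.sum_univ_four, Fin.prod_univ_four]
      exact (((hk 0).mul (hk 1)).mul (hk 2)).mul (hk 3)
    · split_ifs with hi
      · have hKi : MemLine K (x i) := by
          simp only [Finset.mem_insert, Finset.mem_singleton] at hi
          rcases hi with rfl | rfl | rfl | rfl | rfl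
          exacts [hKx 0, hKx 1, hKx 2, hKx 3, hKx 4]
        simpa using (vanishesToOrder_one_of_eval_eq_zero (hKi v hv hvx)).pow f
      · exact vanishesToOrder_zero _ _
  · exact mul_ne_zero (Finset.prod_ne_zero_iff.2 fun k _ => pow_ne_zero _ (h.isLine k).1)
      (pow_ne_zero _ hK0)
  · exact (IsHomogeneous.prod _ _ _ fun k _ => by simpa using (h.isLine k).2.pow (e k)).mul
      (hK.pow f)

lemma IsLabelling.initialDegree_eq (h : IsLabelling Z x N) (e : Fin 4 → ℕ) (f m t : ℕ)
    (hm : ∀ i, m ≤ (∑ k, if i ∈ incidence k then e k else 0) +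
      if i ∈ ({0, 1, 2, 6, 7} : Finset (Fin 8)) then f else 0)
    (ht : ∑ k, e k + 2 * f = t) (htm : 3 * t < 7 * m + 3) :
    initialDegree (symbolicPower Z m) = t := by
  have hmem := h.exists_mem_symbolicPower e f m hm
  rw [ht] at hmem
  refine le_antisymm (Nat.sInf_le hmem) (le_csInf ⟨t, hmem⟩ ?_)
  rintro s ⟨F, hFZ, hF0, hF⟩
  have := h.seven_mul_le hFZ hF0 hF
  lia

end Labelling

/-- Configuration `H(8,137)`: a set of `8` points of `ℙ²` with a line containing exactly five of
them (as in `StandardConfig 5`) has Waldschmidt constant `7/3`, and the first differences of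
the initial sequence are periodic with period `(3,2,2)`. -/
theorem H8_137 (Z : Set (ℙ ℂ (Fin 3 → ℂ)))
    (hfin : Z.Finite) (hcard : Z.ncard = 8) (hconf : StandardConfig 5 Z) :
    waldschmidt Z = 7 / 3 ∧
    ∀ k : ℕ,
      initialDegree (symbolicPower Z (3 * k + 1)) = 7 * k + 3 ∧
      initialDegree (symbolicPower Z (3 * k + 2)) = 7 * k + 5 ∧
      initialDegree (symbolicPower Z (3 * k + 3)) = 7 * k + 7 := by
  obtain ⟨x, N, h⟩ := hconf.exists_isLabelling hfin hcard
  have hseq : ∀ k : ℕ,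
      initialDegree (symbolicPower Z (3 * k + 1)) = 7 * k + 3 ∧
      initialDegree (symbolicPower Z (3 * k + 2)) = 7 * k + 5 ∧
      initialDegree (symbolicPower Z (3 * k + 3)) = 7 * k + 7 := by
    intro k
    refine ⟨h.initialDegree_eq ![2 * k + 1, k + 1, k + 1, k] k _ _ (fun i => ?_) ?_ (by lia),
      h.initialDegree_eq ![2 * k + 2, k + 1, k + 1, k + 1] k _ _ (fun i => ?_) ?_ (by lia),
      h.initialDegree_eq ![2 * k + 2, k + 1, k + 1, k + 1] (k + 1) _ _ (fun i => ?_) ?_ (by lia)⟩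
    all_goals first
      | (simp [Fin.sum_univ_four]; lia)
      | (fin_cases i <;> simp [Fin.sum_univ_four, incidence] <;> lia)
  refine ⟨le_antisymm ?_ (le_ciInf fun m => ?_), hseq⟩
  · refine (ciInf_le ⟨0, ?_⟩ (3 : ℕ+)).trans ?_
    · rintro _ ⟨m, rfl⟩
      positivity
    · have := (hseq 0).2.2
      norm_num at this ⊢
      rw [this]
      norm_num
  · have hm : (0 : ℝ) < ((m : ℕ) : ℝ) := by exact_mod_cast m.pos
    have hle : 7 * (m : ℕ) ≤ 3 * initialDegree (symbolicPower Z m) := by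
      obtain ⟨n, hn⟩ : ∃ n, (m : ℕ) = n + 1 := ⟨_, (Nat.succ_pred_eq_of_pos m.pos).symm⟩
      obtain ⟨k, hk | hk | hk⟩ : ∃ k, n = 3 * k ∨ n = 3 * k + 1 ∨ n = 3 * k + 2 :=
        ⟨n / 3, by lia⟩
      · rw [hn, hk, (hseq k).1]; lia
      · rw [hn, hk, (hseq k).2.1]; lia
      · rw [hn, hk, (hseq k).2.2]; lia
    rw [div_le_div_iff₀ (by norm_num) hm]
    have : (7 * (m : ℕ) : ℝ) ≤ 3 * initialDegree (symbolicPower Z m) := by exact_mod_cast hle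
    linarith
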